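/- The set of points ξ ∈ 𝔠 for which ρ_ξ is faithful — i.e., for every w ∈ F₂ with w ≠ 1 one has w(A_ξ, B_ξ) ≠ ±I — contains a dense G_δ subset of 𝔠. -/

import Mathlib

/-- `SL(2,ℝ)`. -/
abbrev SL2R := Matrix.SpecialLinearGroup (Fin 2) ℝ

/-- The free group `F₂` on two generators. -/
abbrev F2 := FreeGroup Bool

/-- The generator `X` of `F₂`. -/
def Xg : F2 := FreeGroup.of true

/-- The generator `Y` of `F₂`. -/
def Yg : F2 := FreeGroup.of false

/-- For `z > 2`, the unique real `ζ ≥ 1` with `ζ + ζ⁻¹ = z` (junk value `1` otherwise). -/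
noncomputable def zetaOf (z : ℝ) : ℝ :=
  if 2 < z then (z + Real.sqrt (z ^ 2 - 4)) / 2 else 1

lemma zetaOf_ne_zero (z : ℝ) : zetaOf z ≠ 0 := by
  unfold zetaOf
  split_ifs with h
  · have h4 : (0:ℝ) ≤ Real.sqrt (z ^ 2 - 4) := Real.sqrt_nonneg _
    have : 0 < (z + Real.sqrt (z ^ 2 - 4)) / 2 := by nlinarith
    exact ne_of_gt this
  · norm_num

/-- The normal-form matrix `A_ξ = [[x,−1],[1,0]]` as an element of `SL(2,ℝ)`. -/
noncomputable def Amat (x : ℝ) : SL2R :=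
  ⟨!![x, -1; 1, 0], by simp [Matrix.det_fin_two_of]⟩

/-- The normal-form matrix `B_ξ = [[0,ζ⁻¹],[−ζ,y]]` as an element of `SL(2,ℝ)`. -/
noncomputable def Bmat (y z : ℝ) : SL2R :=
  ⟨!![0, (zetaOf z)⁻¹; -(zetaOf z), y], by
    simp [Matrix.det_fin_two_of]
    exact inv_mul_cancel₀ (zetaOf_ne_zero z)⟩

/-- Evaluation of words: the homomorphism `F₂ → SL(2,ℝ)` sending `X ↦ A`, `Y ↦ B`. -/
noncomputable def ev (A B : SL2R) : F2 →* SL2R :=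
  FreeGroup.lift (fun b => if b then A else B)

/-- The (lifted) holonomy representation of `ξ = (x,y,z)`: `w ↦ w(A_ξ, B_ξ)`. -/
noncomputable def rho (ξ : ℝ × ℝ × ℝ) : F2 →* SL2R :=
  ev (Amat ξ.1) (Bmat ξ.2.1 ξ.2.2)

/-- The Fricke–Klein space `𝔠_θ`. -/
def FK (θ : ℝ) : Set (ℝ × ℝ × ℝ) :=
  {p | 2 < p.1 ∧ 2 < p.2.1 ∧ 2 < p.2.2 ∧
    p.1 ^ 2 + p.2.1 ^ 2 + p.2.2 ^ 2 - p.1 * p.2.1 * p.2.2 - 2 = -2 * Real.cos (θ / 2)}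

/-- The full Fricke–Klein space `𝔠`. -/
def FKall : Set (ℝ × ℝ × ℝ) :=
  {p | 2 < p.1 ∧ 2 < p.2.1 ∧ 2 < p.2.2 ∧
    -2 < p.1 ^ 2 + p.2.1 ^ 2 + p.2.2 ^ 2 - p.1 * p.2.1 * p.2.2 - 2 ∧
    p.1 ^ 2 + p.2.1 ^ 2 + p.2.2 ^ 2 - p.1 * p.2.1 * p.2.2 - 2 < 2}

/-- Trace of an element of `SL(2,ℝ)`. -/
noncomputable def trSL (A : SL2R) : ℝ := Matrix.trace (A : Matrix (Fin 2) (Fin 2) ℝ)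

/-- The matrix `[[0, e⁻ˡ], [-eˡ, y]]`, the normal form `Bmat` with `ζ = eˡ`. -/
noncomputable def Bexp (y l : ℝ) : SL2R :=
  ⟨!![0, Real.exp (-l); -Real.exp l, y], by
    simp [Matrix.det_fin_two_of, ← Real.exp_add]⟩

lemma zetaOf_add_inv {ζ : ℝ} (h : 1 < ζ) : zetaOf (ζ + ζ⁻¹) = ζ := by
  have h0 : 0 < ζ := by linarith
  have hz : 2 < ζ + ζ⁻¹ := by
    have : ζ + ζ⁻¹ - 2 = (ζ - 1) ^ 2 / ζ := by field_simp; ring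
    have : 0 < (ζ - 1) ^ 2 / ζ := by
      have : 0 < ζ - 1 := by linarith
      positivity
    linarith
  have hs : (ζ + ζ⁻¹) ^ 2 - 4 = (ζ - ζ⁻¹) ^ 2 := by field_simp; ring
  have hi : ζ⁻¹ < 1 := inv_lt_one_of_one_lt₀ h
  rw [zetaOf, if_pos hz, hs, Real.sqrt_sq (by linarith)]
  ring

lemma one_lt_zetaOf {z : ℝ} (h : 2 < z) : 1 < zetaOf z := by
  rw [zetaOf, if_pos h]
  have := Real.sqrt_nonneg (z ^ 2 - 4)
  linarith

lemma zetaOf_add_inv_self {z : ℝ} (h : 2 < z) : zetaOf z + (zetaOf z)⁻¹ = z := by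
  have h1 : zetaOf z ≠ 0 := zetaOf_ne_zero z
  field_simp
  rw [zetaOf, if_pos h]
  have := Real.sq_sqrt (show 0 ≤ z ^ 2 - 4 by nlinarith)
  linear_combination this / 4

lemma Bmat_eq_Bexp (y : ℝ) {l : ℝ} (hl : 0 < l) :
    Bmat y (Real.exp l + Real.exp (-l)) = Bexp y l := by
  have h : zetaOf (Real.exp l + Real.exp (-l)) = Real.exp l := by
    rw [Real.exp_neg]
    exact zetaOf_add_inv (Real.one_lt_exp_iff.2 hl)
  apply Subtype.ext
  simp only [Bmat, Bexp, h]
  rw [Real.exp_neg]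

lemma continuousAt_zetaOf {z : ℝ} (h : 2 < z) : ContinuousAt zetaOf z := by
  have : ContinuousAt (fun z : ℝ => (z + Real.sqrt (z ^ 2 - 4)) / 2) z := by fun_prop
  refine this.congr ?_
  filter_upwards [lt_mem_nhds h] with t ht
  simp [zetaOf, ht]

/-- Entries of a word are analytic in a parameter if those of the generators are. -/
lemma analyticAt_ev_apply {A B : ℝ → SL2R} {s : ℝ}
    (hA : ∀ i j, AnalyticAt ℝ (fun t => (A t : Matrix (Fin 2) (Fin 2) ℝ) i j) s)
    (hB : ∀ i j, AnalyticAt ℝ (fun t => (B t : Matrix (Fin 2) (Fin 2) ℝ) i j) s) (w : F2) :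
    ∀ i j, AnalyticAt ℝ (fun t => (ev (A t) (B t) w : Matrix (Fin 2) (Fin 2) ℝ) i j) s := by
  have inv : ∀ g : ℝ → SL2R,
      (∀ i j, AnalyticAt ℝ (fun t => (g t : Matrix (Fin 2) (Fin 2) ℝ) i j) s) →
      ∀ i j, AnalyticAt ℝ (fun t => ((g t)⁻¹ : SL2R).1 i j) s := by
    intro g hg i j
    fin_cases i <;> fin_cases j <;>
      simp [Matrix.SpecialLinearGroup.coe_inv, Matrix.adjugate_fin_two]
    · exact hg 1 1
    · exact (hg 0 1).neg
    · exact (hg 1 0).neg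
    · exact hg 0 0
  have gen : ∀ b i j,
      AnalyticAt ℝ (fun t => (ev (A t) (B t) (FreeGroup.of b) :
        Matrix (Fin 2) (Fin 2) ℝ) i j) s := by
    intro b i j
    cases b
    · simpa [ev] using hB i j
    · simpa [ev] using hA i j
  induction w using FreeGroup.induction_on with
  | C1 => intro i j; simpa using analyticAt_const
  | of b => exact gen b
  | inv_of b _ => simpa only [map_inv] using inv _ (gen b)
  | mul v w hv hw =>
    intro i j
    simp only [map_mul, Matrix.SpecialLinearGroup.coe_mul, Matrix.mul_apply, Fin.sum_univ_two]
    exact ((hv i 0).mul (hw 0 j)).add ((hv i 1).mul (hw 1 j))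

lemma continuous_rho_apply (w : F2) : Continuous fun ξ : ↥FKall => rho ξ.1 w := by
  have hz : Continuous fun ξ : ↥FKall => zetaOf ξ.1.2.2 :=
    continuous_iff_continuousAt.2 fun ξ =>
      ContinuousAt.comp (f := fun ξ : ↥FKall => ξ.1.2.2) (continuousAt_zetaOf ξ.2.2.2.1)
        (by fun_prop)
  have hzi : Continuous fun ξ : ↥FKall => (zetaOf ξ.1.2.2)⁻¹ :=
    hz.inv₀ fun _ => zetaOf_ne_zero _
  have gen : ∀ b, Continuous fun ξ : ↥FKall => rho ξ.1 (FreeGroup.of b) := by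
    intro b
    refine continuous_induced_rng.2 (continuous_matrix fun i j => ?_)
    cases b <;> fin_cases i <;> fin_cases j <;> simp [rho, ev, Amat, Bmat] <;> fun_prop
  induction w using FreeGroup.induction_on with
  | C1 => simpa using continuous_const
  | of b => exact gen b
  | inv_of b _ => simp only [map_inv]; exact (gen b).inv
  | mul v w hv hw => simp only [map_mul]; exact hv.mul hw

lemma isOpen_FKall : IsOpen FKall := by
  unfold FKall
  refine (isOpen_lt ?_ ?_).and <| (isOpen_lt ?_ ?_).and <| (isOpen_lt ?_ ?_).and <|
    (isOpen_lt ?_ ?_).and (isOpen_lt ?_ ?_) <;> fun_prop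

open UpperHalfPlane Pointwise in
/-- Ping-pong on the upper half-plane for a pair of parabolics generating, up to signs, the
principal congruence subgroup of level two. -/
lemma injective_ev_parabolic : Function.Injective (ev (Amat 2) (Bexp (-2) 0)) := by
  let a : Bool → SL2R := fun b => if b then Amat 2 else Bexp (-2) 0
  let P : Bool → Set ℍ := fun b =>
    if b then {τ | 1 ≤ τ.re} else {τ | τ.re ^ 2 + τ.im ^ 2 ≤ -τ.re}
  let Q : Bool → Set ℍ := fun b =>
    if b then {τ | τ.re ^ 2 + τ.im ^ 2 < τ.re} else {τ | τ.re < -1}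
  have hP : ∀ b, a b • (Q b)ᶜ ⊆ P b := by
    rintro b _ ⟨τ, hτ, rfl⟩
    have hi := τ.im_pos
    cases b
    · have h1 : -1 ≤ τ.re := by simpa [Q] using hτ
      have hd : 0 < (τ.re + 2) ^ 2 + τ.im ^ 2 := by positivity
      have hc : ((Bexp (-2) 0 • τ : ℍ) : ℂ) = -((τ : ℂ) + 2)⁻¹ := by
        rw [coe_specialLinearGroup_apply]
        simp [Bexp]
        rw [← inv_neg]; congr 1; ring
      have hre : (Bexp (-2) 0 • τ : ℍ).re = -((τ.re + 2) / ((τ.re + 2) ^ 2 + τ.im ^ 2)) := by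
        rw [← coe_re, hc]; simp [Complex.inv_re, Complex.normSq_apply, pow_two]
      have him : (Bexp (-2) 0 • τ : ℍ).im = τ.im / ((τ.re + 2) ^ 2 + τ.im ^ 2) := by
        rw [← coe_im, hc]; simp [Complex.inv_im, Complex.normSq_apply, pow_two]; ring
      change (Bexp (-2) 0 • τ : ℍ).re ^ 2 + (Bexp (-2) 0 • τ : ℍ).im ^ 2 ≤
        -(Bexp (-2) 0 • τ : ℍ).re
      rw [hre, him, neg_neg]
      have : (-((τ.re + 2) / ((τ.re + 2) ^ 2 + τ.im ^ 2))) ^ 2 +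
          (τ.im / ((τ.re + 2) ^ 2 + τ.im ^ 2)) ^ 2 = 1 / ((τ.re + 2) ^ 2 + τ.im ^ 2) := by
        field_simp
      rw [this]
      gcongr
      linarith
    · have h1 : τ.re ≤ τ.re ^ 2 + τ.im ^ 2 := by simpa [Q] using hτ
      have hd : 0 < τ.re ^ 2 + τ.im ^ 2 := by positivity
      have hc : ((Amat 2 • τ : ℍ) : ℂ) = 2 - (τ : ℂ)⁻¹ := by
        have := τ.ne_zero
        rw [coe_specialLinearGroup_apply]
        simp [Amat]
        field_simp
        ring
      have hre : (Amat 2 • τ : ℍ).re = 2 - τ.re / (τ.re ^ 2 + τ.im ^ 2) := by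
        rw [← coe_re, hc]; simp [Complex.inv_re, Complex.normSq_apply, pow_two]
      change 1 ≤ (Amat 2 • τ : ℍ).re
      rw [hre]
      have := (div_le_one hd).2 h1
      linarith
  refine FreeGroup.injective_lift_of_ping_pong a P Q ?_ ?_ ?_ ?_ hP ?_
  · rintro (_ | _)
    · refine ⟨⟨⟨-1 / 2, 1 / 2⟩, by norm_num⟩, ?_⟩
      simp [P]; norm_num
    · exact ⟨⟨⟨1, 1⟩, by norm_num⟩, by simp [P]⟩
  · rintro (_ | _) (_ | _) h <;> first | exact absurd rfl h | skip
    all_goals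
      refine Set.disjoint_left.2 fun τ h1 h2 => ?_
      have := τ.im_pos
      simp [P] at h1 h2
      nlinarith
  · rintro (_ | _) (_ | _) h <;> first | exact absurd rfl h | skip
    all_goals
      refine Set.disjoint_left.2 fun τ h1 h2 => ?_
      have := τ.im_pos
      simp [Q] at h1 h2
      nlinarith
  · rintro (_ | _) (_ | _)
    all_goals
      refine Set.disjoint_left.2 fun τ h1 h2 => ?_
      have := τ.im_pos
      simp [P, Q] at h1 h2
      nlinarith
  · rintro b _ ⟨τ, hτ, rfl⟩
    by_contra h
    refine hτ (hP b ⟨_, h, ?_⟩)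
    exact smul_inv_smul _ _

/-- A nontrivial word is not identically trivial near any point of the Fricke-Klein space. -/
lemma dense_rho_apply_ne_one {w : F2} (hw : w ≠ 1) :
    Dense {ξ : ↥FKall | rho ξ.1 w ≠ 1} := by
  change Dense {ξ : ↥FKall | rho ξ.1 w = 1}ᶜ
  rw [← interior_eq_empty_iff_dense_compl, Set.eq_empty_iff_forall_notMem]
  intro ξ hξ
  obtain ⟨⟨x, y, z⟩, hx⟩ := ξ
  have hz : 2 < z := hx.2.2.1
  set l := Real.log (zetaOf z) with hl
  have hl0 : 0 < l := Real.log_pos (one_lt_zetaOf hz)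
  have hel : Real.exp l = zetaOf z := Real.exp_log (by linarith [one_lt_zetaOf hz])
  let γ : ℝ → ℝ × ℝ × ℝ := fun s =>
    (x + s * (2 - x), y + s * (-2 - y),
      Real.exp ((1 - s) * l) + Real.exp (-((1 - s) * l)))
  have hγ : Continuous γ := by fun_prop
  have hγ0 : γ 0 = (x, y, z) := by
    simp [γ, Real.exp_neg, hel, zetaOf_add_inv_self hz]
  have hnhds : ∀ᶠ p in nhds (x, y, z), rho p w = 1 := by
    have := mem_interior_iff_mem_nhds.1 hξ
    rw [nhds_subtype_eq_comap, Filter.mem_comap] at this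
    obtain ⟨t, ht, hts⟩ := this
    filter_upwards [ht, isOpen_FKall.mem_nhds hx] with p hp hp'
    exact @hts ⟨p, hp'⟩ hp
  let g : ℝ → SL2R := fun s =>
    ev (Amat (x + s * (2 - x))) (Bexp (y + s * (-2 - y)) ((1 - s) * l)) w
  have hg : ∀ᶠ s in nhds (0 : ℝ), g s = 1 := by
    have h1 : ∀ᶠ s in nhds (0 : ℝ), rho (γ s) w = 1 :=
      hγ.continuousAt.eventually (by rwa [hγ0])
    filter_upwards [h1, gt_mem_nhds one_pos] with s hs hs1
    rwa [rho, Bmat_eq_Bexp _ (mul_pos (by linarith) hl0)] at hs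
  have hg1 : g 1 = 1 := by
    ext i j
    have han : AnalyticOnNhd ℝ (fun s => (g s : Matrix (Fin 2) (Fin 2) ℝ) i j) Set.univ := by
      intro s _
      refine analyticAt_ev_apply ?_ ?_ w i j
      · intro i j
        fin_cases i <;> fin_cases j <;> simp [Amat] <;> fun_prop
      · intro i j
        fin_cases i <;> fin_cases j <;> simp [Bexp] <;> fun_prop
    refine congrFun (han.eq_of_eventuallyEq (g := fun _ => (1 : SL2R).1 i j)
      analyticOnNhd_const (z₀ := 0) ?_) 1
    filter_upwards [hg] with s hs
    rw [hs]
  refine hw (injective_ev_parabolic ?_)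
  simpa [g] using hg1

/-- The set of `ξ ∈ 𝔠` with `ρ_ξ` faithful contains a dense `G_δ`
subset of `𝔠`. -/
theorem stmt_3 :
    ∃ S : Set ↥FKall, IsGδ S ∧ Dense S ∧
      ∀ ξ ∈ S, ∀ w : F2, w ≠ 1 →
        ((rho ξ.1 w : Matrix (Fin 2) (Fin 2) ℝ) ≠ 1 ∧
         (rho ξ.1 w : Matrix (Fin 2) (Fin 2) ℝ) ≠ -1) := by
  have : BaireSpace ↥FKall := isOpen_FKall.isOpenEmbedding_subtypeVal.baireSpace
  have hopen : ∀ w : {w : F2 // w ≠ 1}, IsOpen {ξ : ↥FKall | rho ξ.1 w ≠ 1} := fun w =>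
    isOpen_ne.preimage (continuous_rho_apply w)
  refine ⟨⋂ w : {w : F2 // w ≠ 1}, {ξ | rho ξ.1 w ≠ 1}, .iInter_of_isOpen hopen,
    dense_iInter_of_isOpen hopen fun w => dense_rho_apply_ne_one w.2, ?_⟩
  intro ξ hξ w hw
  have hξ' : ∀ v : F2, v ≠ 1 → rho ξ.1 v ≠ 1 := fun v hv => Set.mem_iInter.1 hξ ⟨v, hv⟩
  refine ⟨fun h => hξ' w hw (Subtype.ext h), fun h => ?_⟩
  refine hξ' (w ^ 2) (fun h2 => hw ((pow_eq_one_iff_left two_ne_zero).1 h2)) (Subtype.ext ?_)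
  simp [h]
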